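/- If X is sampled uniformly from GL_N(Z/mZ), then for every W in M_S(Z/mZ), the probability P(X[S] = W) converges to m^{−S²} as N → ∞; i.e., the law of the truncated corner converges to the uniform distribution on M_S(Z/mZ). -/

import Mathlib

open Filter

namespace Matrix

section Corner

variable {R α β : Type*} [CommRing R] [Fintype α] [Fintype β] [DecidableEq α] [DecidableEq β]

/-- The block upper triangular matrix with identity diagonal blocks. -/
def upperUnipotent (A : Matrix α β R) : GL (α ⊕ β) R where
  val := fromBlocks 1 A 0 1
  inv := fromBlocks 1 (-A) 0 1
  val_inv := by simp [fromBlocks_multiply]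
  inv_val := by simp [fromBlocks_multiply]

/-- The block lower triangular matrix with identity diagonal blocks. -/
def lowerUnipotent (B : Matrix β α R) : GL (α ⊕ β) R where
  val := fromBlocks 1 0 B 1
  inv := fromBlocks 1 0 (-B) 1
  val_inv := by simp [fromBlocks_multiply]
  inv_val := by simp [fromBlocks_multiply]

theorem toBlocks₁₁_upperUnipotent_mul (A : Matrix α β R) (X : GL (α ⊕ β) R) :
    (upperUnipotent A * X).val.toBlocks₁₁ = X.val.toBlocks₁₁ + A * X.val.toBlocks₂₁ := by
  rw [Units.val_mul, ← fromBlocks_toBlocks X.val]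
  simp [upperUnipotent, fromBlocks_multiply]

theorem toBlocks₂₁_upperUnipotent_mul (A : Matrix α β R) (X : GL (α ⊕ β) R) :
    (upperUnipotent A * X).val.toBlocks₂₁ = X.val.toBlocks₂₁ := by
  rw [Units.val_mul, ← fromBlocks_toBlocks X.val]
  simp [upperUnipotent, fromBlocks_multiply]

theorem toBlocks₁₁_lowerUnipotent_mul (B : Matrix β α R) (X : GL (α ⊕ β) R) :
    (lowerUnipotent B * X).val.toBlocks₁₁ = X.val.toBlocks₁₁ := by
  rw [Units.val_mul, ← fromBlocks_toBlocks X.val]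
  simp [lowerUnipotent, fromBlocks_multiply]

theorem toBlocks₂₁_lowerUnipotent_mul (B : Matrix β α R) (X : GL (α ⊕ β) R) :
    (lowerUnipotent B * X).val.toBlocks₂₁ = B * X.val.toBlocks₁₁ + X.val.toBlocks₂₁ := by
  rw [Units.val_mul, ← fromBlocks_toBlocks X.val]
  simp [lowerUnipotent, fromBlocks_multiply]

/-- A matrix whose rows all lie in a proper submodule has no left inverse. -/
theorem eq_top_of_mul_eq_one {γ : Type*} [Fintype γ] {Z : Matrix α γ R} {M : Matrix γ α R}
    (h : Z * M = 1) {K : Submodule R (α → R)} (hK : ∀ i, M i ∈ K) : K = ⊤ := by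
  rw [eq_top_iff]
  intro v _
  have hv : v = (v ᵥ* Z) ᵥ* M := by rw [vecMul_vecMul, h, vecMul_one]
  rw [hv, vecMul_eq_sum]
  exact K.sum_mem fun i _ => K.smul_mem _ (hK i)

omit [Fintype α] in
/-- The rows of a matrix without left inverse lie in a proper submodule. -/
theorem exists_ne_top_of_not_exists_mul_eq_one {M : Matrix β α R}
    (h : ¬ ∃ Z : Matrix α β R, Z * M = 1) :
    ∃ K : Submodule R (α → R), K ≠ ⊤ ∧ ∀ i, M i ∈ K := by
  refine ⟨LinearMap.range M.vecMulLinear, fun htop => h ?_, fun i => ⟨Pi.single i 1, by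
    rw [vecMulLinear_apply, single_one_vecMul]; rfl⟩⟩
  have hs : ∀ i : α, ∃ z, z ᵥ* M = Pi.single i 1 := fun i => LinearMap.range_eq_top.1 htop _
  choose z hz using hs
  refine ⟨of z, ?_⟩
  ext i j
  have := congrFun (hz i) j
  simpa [Matrix.one_apply, Pi.single_apply, eq_comm, mul_apply, vecMul, dotProduct] using this

theorem exists_toBlocks₁₁_notMem {K : Submodule R (α → R)} (hK : K ≠ ⊤) {X : GL (α ⊕ β) R}
    (hX : ∀ j, X.val.toBlocks₂₁ j ∈ K) : ∃ i, X.val.toBlocks₁₁ i ∉ K := by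
  by_contra! h
  have h1 : X⁻¹.val * X.val = 1 := X.inv_val
  have h2 : X⁻¹.val.submatrix Sum.inl id * X.val.submatrix id Sum.inl = (1 : Matrix α α R) := by
    rw [← submatrix_mul _ _ _ _ _ Function.bijective_id, h1]
    exact submatrix_one _ Sum.inl_injective
  refine hK (eq_top_of_mul_eq_one h2 ?_)
  rintro (i | j)
  exacts [h i, hX j]

variable [Finite R]

theorem card_toBlocks₂₁_mem_le {K : Submodule R (α → R)} (hK : K ≠ ⊤) :
    Nat.card {X : GL (α ⊕ β) R // ∀ j, X.val.toBlocks₂₁ j ∈ K} * 2 ^ Fintype.card β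
      ≤ Nat.card (GL (α ⊕ β) R) := by
  classical
  have hc : ∀ M : Matrix α α R, ∃ i, (∃ i', M i' ∉ K) → M i ∉ K := by
    intro M
    by_cases h : ∃ i', M i' ∉ K
    · exact ⟨h.choose, fun _ => h.choose_spec⟩
    · have : Nonempty α := by
        by_contra hα
        rw [not_nonempty_iff] at hα
        exact hK (Subsingleton.elim _ _)
      exact ⟨this.some, fun h' => (h h').elim⟩
  choose i hi using hc
  let B : Matrix α α R → (β → Bool) → Matrix β α R :=
    fun M ε => of fun j => if ε j then Pi.single (i M) 1 else 0
  have hB : ∀ M ε j, (B M ε * M) j = if ε j then M (i M) else 0 := by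
    intro M ε j
    ext k
    by_cases h : ε j <;> simp [B, mul_apply, h, Pi.single_apply]
  let f : {X : GL (α ⊕ β) R // ∀ j, X.val.toBlocks₂₁ j ∈ K} × (β → Bool) → GL (α ⊕ β) R :=
    fun p => lowerUnipotent (B p.1.1.val.toBlocks₁₁ p.2) * p.1.1
  have hf : Function.Injective f := by
    rintro ⟨⟨X, hX⟩, ε⟩ ⟨⟨Y, hY⟩, δ⟩ h
    simp only [f] at h
    have h11 : X.val.toBlocks₁₁ = Y.val.toBlocks₁₁ := by
      rw [← toBlocks₁₁_lowerUnipotent_mul (B X.val.toBlocks₁₁ ε) X, h,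
        toBlocks₁₁_lowerUnipotent_mul]
    have h21 := congrArg (fun Z : GL (α ⊕ β) R => Z.val.toBlocks₂₁) h
    simp only [toBlocks₂₁_lowerUnipotent_mul] at h21
    have hM := hi _ (exists_toBlocks₁₁_notMem hK hX)
    rw [← h11] at h21 h
    have hε : ε = δ := by
      funext j
      have hj : (B X.val.toBlocks₁₁ ε * X.val.toBlocks₁₁) j + X.val.toBlocks₂₁ j
          = (B X.val.toBlocks₁₁ δ * X.val.toBlocks₁₁) j + Y.val.toBlocks₂₁ j := congrFun h21 j
      rw [hB, hB] at hj
      have hXj := hX j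
      have hYj := hY j
      cases h1 : ε j <;> cases h2 : δ j <;> simp only [h1, h2] at hj ⊢
      · simp only [Bool.false_eq_true, if_false, if_true, zero_add] at hj
        rw [hj] at hXj
        exact (hM ((K.add_mem_iff_left hYj).1 hXj)).elim
      · simp only [Bool.false_eq_true, if_false, if_true, zero_add] at hj
        rw [← hj] at hYj
        exact (hM ((K.add_mem_iff_left hXj).1 hYj)).elim
    subst hε
    simpa using h
  have := Nat.card_le_card_of_injective f hf
  simpa [Nat.card_prod] using this

theorem card_not_exists_mul_toBlocks₂₁_eq_one_le :
    Nat.card {X : GL (α ⊕ β) R // ¬ ∃ Z : Matrix α β R, Z * X.val.toBlocks₂₁ = 1}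
        * 2 ^ Fintype.card β
      ≤ Nat.card (Submodule R (α → R)) * Nat.card (GL (α ⊕ β) R) := by
  classical
  have := Fintype.ofFinite (Submodule R (α → R))
  have h1 : Nat.card {X : GL (α ⊕ β) R // ¬ ∃ Z : Matrix α β R, Z * X.val.toBlocks₂₁ = 1}
      ≤ ∑ K : {K : Submodule R (α → R) // K ≠ ⊤},
        Nat.card {X : GL (α ⊕ β) R // ∀ j, X.val.toBlocks₂₁ j ∈ K.1} := by
    rw [← Nat.card_sigma]
    choose K hK hX using fun X : {X : GL (α ⊕ β) R //
      ¬ ∃ Z : Matrix α β R, Z * X.val.toBlocks₂₁ = 1} =>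
      exists_ne_top_of_not_exists_mul_eq_one X.2
    refine Nat.card_le_card_of_injective (fun X => ⟨⟨K X, hK X⟩, ⟨X.1, hX X⟩⟩) ?_
    intro X Y h
    have := congrArg (fun p : (Σ K : {K : Submodule R (α → R) // K ≠ ⊤},
      {X : GL (α ⊕ β) R // ∀ j, X.val.toBlocks₂₁ j ∈ K.1}) => p.2.1) h
    exact Subtype.ext this
  calc _ ≤ _ := Nat.mul_le_mul_right _ h1
    _ ≤ ∑ K : {K : Submodule R (α → R) // K ≠ ⊤}, Nat.card (GL (α ⊕ β) R) := by
      rw [Finset.sum_mul]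
      exact Finset.sum_le_sum fun K _ => card_toBlocks₂₁_mem_le K.2
    _ ≤ _ := by
      rw [Finset.sum_const, smul_eq_mul, Finset.card_univ, ← Nat.card_eq_fintype_card]
      exact Nat.mul_le_mul_right _ (Finite.card_subtype_le _)

theorem card_exists_mul_toBlocks₂₁_eq_one_le (W W' : Matrix α α R) :
    Nat.card {X : GL (α ⊕ β) R //
        (∃ Z : Matrix α β R, Z * X.val.toBlocks₂₁ = 1) ∧ X.val.toBlocks₁₁ = W}
      ≤ Nat.card {X : GL (α ⊕ β) R //
        (∃ Z : Matrix α β R, Z * X.val.toBlocks₂₁ = 1) ∧ X.val.toBlocks₁₁ = W'} := by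
  classical
  have hex : ∀ M : Matrix β α R, ∃ z : Matrix α β R,
      (∃ Z : Matrix α β R, Z * M = (1 : Matrix α α R)) → z * M = (1 : Matrix α α R) := by
    intro M
    by_cases h : ∃ Z : Matrix α β R, Z * M = (1 : Matrix α α R)
    · exact ⟨h.choose, fun _ => h.choose_spec⟩
    · exact ⟨0, fun h' => (h h').elim⟩
  choose z hz using hex
  refine Nat.card_le_card_of_injective (fun X =>
    ⟨upperUnipotent ((W' - W) * z X.1.val.toBlocks₂₁) * X.1, ?_, ?_⟩) ?_
  · rw [toBlocks₂₁_upperUnipotent_mul]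
    exact X.2.1
  · rw [toBlocks₁₁_upperUnipotent_mul, Matrix.mul_assoc, hz _ X.2.1, X.2.2]
    simp
  · rintro ⟨X, hX⟩ ⟨Y, hY⟩ h
    simp only [Subtype.mk.injEq] at h ⊢
    have h21 : X.val.toBlocks₂₁ = Y.val.toBlocks₂₁ := by
      rw [← toBlocks₂₁_upperUnipotent_mul ((W' - W) * z X.val.toBlocks₂₁) X, h,
        toBlocks₂₁_upperUnipotent_mul]
    rw [h21] at h
    exact mul_left_cancel h

theorem card_mul_card_exists_mul_toBlocks₂₁_eq_one (W : Matrix α α R) :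
    Nat.card (Matrix α α R) * Nat.card {X : GL (α ⊕ β) R //
        (∃ Z : Matrix α β R, Z * X.val.toBlocks₂₁ = 1) ∧ X.val.toBlocks₁₁ = W}
      = Nat.card {X : GL (α ⊕ β) R // ∃ Z : Matrix α β R, Z * X.val.toBlocks₂₁ = 1} := by
  classical
  have := Fintype.ofFinite (Matrix α α R)
  rw [← Nat.card_congr (Equiv.sigmaFiberEquiv (fun X : {X : GL (α ⊕ β) R //
    ∃ Z : Matrix α β R, Z * X.val.toBlocks₂₁ = 1} => X.1.val.toBlocks₁₁)), Nat.card_sigma,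
    Nat.card_eq_fintype_card, ← Finset.card_univ, ← smul_eq_mul, ← Finset.sum_const]
  refine Finset.sum_congr rfl fun W' _ => ?_
  rw [Nat.card_congr (Equiv.subtypeSubtypeEquivSubtypeInter
    (fun X : GL (α ⊕ β) R => ∃ Z : Matrix α β R, Z * X.val.toBlocks₂₁ = 1)
    (fun X => X.val.toBlocks₁₁ = W'))]
  exact le_antisymm (card_exists_mul_toBlocks₂₁_eq_one_le _ _)
    (card_exists_mul_toBlocks₂₁_eq_one_le _ _)

/-- Quantitative equidistribution of the upper-left corner of a uniform invertible matrix. -/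
theorem abs_card_toBlocks₁₁_div_sub_le (W : Matrix α α R) :
    |(Nat.card {X : GL (α ⊕ β) R // X.val.toBlocks₁₁ = W} : ℝ) / Nat.card (GL (α ⊕ β) R)
        - (Nat.card (Matrix α α R) : ℝ)⁻¹|
      ≤ Nat.card (Submodule R (α → R)) * (1 / 2) ^ Fintype.card β := by
  classical
  have hq : 1 ≤ Nat.card (Matrix α α R) := Nat.card_pos
  have hG : 0 < Nat.card (GL (α ⊕ β) R) := Nat.card_pos
  have hbad := card_not_exists_mul_toBlocks₂₁_eq_one_le (R := R) (α := α) (β := β)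
  have hgood := card_mul_card_exists_mul_toBlocks₂₁_eq_one (β := β) W
  have hsum : Nat.card {X : GL (α ⊕ β) R // ∃ Z : Matrix α β R, Z * X.val.toBlocks₂₁ = 1}
      + Nat.card {X : GL (α ⊕ β) R // ¬ ∃ Z : Matrix α β R, Z * X.val.toBlocks₂₁ = 1}
      = Nat.card (GL (α ⊕ β) R) := by
    rw [← Nat.card_sum]
    exact Nat.card_congr (Equiv.sumCompl _)
  have hlow : Nat.card {X : GL (α ⊕ β) R //
        (∃ Z : Matrix α β R, Z * X.val.toBlocks₂₁ = 1) ∧ X.val.toBlocks₁₁ = W}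
      ≤ Nat.card {X : GL (α ⊕ β) R // X.val.toBlocks₁₁ = W} :=
    Nat.card_le_card_of_injective (fun X => ⟨X.1, X.2.2⟩)
      fun X Y h => Subtype.ext (Subtype.mk.inj h)
  have hup : Nat.card {X : GL (α ⊕ β) R // X.val.toBlocks₁₁ = W}
      ≤ Nat.card {X : GL (α ⊕ β) R //
          (∃ Z : Matrix α β R, Z * X.val.toBlocks₂₁ = 1) ∧ X.val.toBlocks₁₁ = W}
        + Nat.card {X : GL (α ⊕ β) R // ¬ ∃ Z : Matrix α β R, Z * X.val.toBlocks₂₁ = 1} := by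
    rw [← Nat.card_sum]
    refine Nat.card_le_card_of_injective
      (fun X => if h : ∃ Z : Matrix α β R, Z * X.1.val.toBlocks₂₁ = 1
        then Sum.inl ⟨X.1, h, X.2⟩ else Sum.inr ⟨X.1, h⟩) fun X Y h => ?_
    dsimp only at h
    split_ifs at h <;> simpa [Subtype.ext_iff] using h
  generalize Nat.card (Matrix α α R) = q at *
  generalize Nat.card (GL (α ⊕ β) R) = G at *
  generalize Nat.card (Submodule R (α → R)) = c at *
  generalize Nat.card {X : GL (α ⊕ β) R // X.val.toBlocks₁₁ = W} = w at *
  generalize Nat.card {X : GL (α ⊕ β) R //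
    (∃ Z : Matrix α β R, Z * X.val.toBlocks₂₁ = 1) ∧ X.val.toBlocks₁₁ = W} = g at *
  generalize Nat.card {X : GL (α ⊕ β) R //
    ¬ ∃ Z : Matrix α β R, Z * X.val.toBlocks₂₁ = 1} = b at *
  rw [← hgood] at hsum
  have hq' : (1 : ℝ) ≤ q := by exact_mod_cast hq
  have hG' : (0 : ℝ) < G := by exact_mod_cast hG
  have hbad' : (b : ℝ) * 2 ^ Fintype.card β ≤ c * G := by exact_mod_cast hbad
  have hsum' : (q : ℝ) * g + b = G := by exact_mod_cast hsum
  have hlow' : (g : ℝ) ≤ w := by exact_mod_cast hlow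
  have hup' : (w : ℝ) ≤ g + b := by exact_mod_cast hup
  have hb0 : (0 : ℝ) ≤ b := b.cast_nonneg
  have h1 : (w : ℝ) / G - (q : ℝ)⁻¹ = (q * w - G) / (q * G) := by field_simp
  have h2 : |(q * w - G : ℝ)| ≤ q * b := by
    rw [abs_le]
    constructor <;> nlinarith
  have h3 : (b : ℝ) / G ≤ c * (1 / 2) ^ Fintype.card β := by
    rw [div_le_iff₀ hG', one_div, inv_pow, mul_right_comm, ← div_eq_mul_inv,
      le_div_iff₀ (by positivity)]
    exact hbad'
  refine le_trans ?_ h3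
  rw [h1, abs_div, abs_of_pos (by positivity : (0 : ℝ) < q * G),
    ← mul_div_mul_left (b : ℝ) G (by positivity : (q : ℝ) ≠ 0)]
  gcongr

end Corner

end Matrix

theorem stmt_8 (m : ℕ) (hm : 2 ≤ m) (S : ℕ) (hS : 1 ≤ S)
    (W : Matrix (Fin S) (Fin S) (ZMod m)) :
    Tendsto (fun n : ℕ =>
        (Nat.card {X : GL (Fin (S + n)) (ZMod m) //
            (fun i j : Fin S => (X : Matrix (Fin (S + n)) (Fin (S + n)) (ZMod m))
              (Fin.castLE (Nat.le_add_right S n) i)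
              (Fin.castLE (Nat.le_add_right S n) j)) = W} : ℝ) /
          (Nat.card (GL (Fin (S + n)) (ZMod m)) : ℝ))
      atTop (nhds (((m : ℝ) ^ (S ^ 2))⁻¹)) := by
  have : NeZero m := ⟨by omega⟩
  have hq : (Nat.card (Matrix (Fin S) (Fin S) (ZMod m)) : ℝ) = (m : ℝ) ^ (S ^ 2) := by
    have h : Nat.card (Matrix (Fin S) (Fin S) (ZMod m)) = m ^ (S ^ 2) := by
      rw [Matrix, Nat.card_fun, Nat.card_fun]
      simp [← pow_mul, sq]
    exact_mod_cast h
  have hlim : Tendsto (fun n : ℕ => (Nat.card (Submodule (ZMod m) (Fin S → ZMod m)) : ℝ)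
      * (1 / 2) ^ n) atTop (nhds 0) := by
    simpa using (tendsto_pow_atTop_nhds_zero_of_lt_one (by norm_num : (0 : ℝ) ≤ 1 / 2)
      (by norm_num)).const_mul (Nat.card (Submodule (ZMod m) (Fin S → ZMod m)) : ℝ)
  rw [tendsto_iff_dist_tendsto_zero]
  refine squeeze_zero (fun _ => dist_nonneg) (fun n => ?_) hlim
  have h := Matrix.abs_card_toBlocks₁₁_div_sub_le (β := Fin n) W
  rw [Fintype.card_fin, hq] at h
  let e : GL (Fin S ⊕ Fin n) (ZMod m) ≃* GL (Fin (S + n)) (ZMod m) :=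
    Units.mapEquiv (Matrix.reindexAlgEquiv (ZMod m) (ZMod m) finSumFinEquiv).toMulEquiv
  have he : ∀ X : GL (Fin S ⊕ Fin n) (ZMod m), X.val.toBlocks₁₁ = W ↔
      (fun i j : Fin S => ((e X : GL (Fin (S + n)) (ZMod m)) :
        Matrix (Fin (S + n)) (Fin (S + n)) (ZMod m))
          (Fin.castLE (Nat.le_add_right S n) i) (Fin.castLE (Nat.le_add_right S n) j)) = W := by
    intro X
    have hcast : ∀ i : Fin S, finSumFinEquiv.symm (Fin.castLE (Nat.le_add_right S n) i)
        = Sum.inl i := fun i => finSumFinEquiv_symm_apply_castAdd i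
    have hX : X.val.toBlocks₁₁ = fun i j : Fin S => ((e X : GL (Fin (S + n)) (ZMod m)) :
        Matrix (Fin (S + n)) (Fin (S + n)) (ZMod m))
          (Fin.castLE (Nat.le_add_right S n) i) (Fin.castLE (Nat.le_add_right S n) j) := by
      funext i j
      simp [e, hcast, Matrix.toBlocks₁₁]
    exact Iff.of_eq (congrArg (· = W) hX)
  rw [Real.dist_eq, ← Nat.card_congr e.toEquiv, ← Nat.card_congr (e.toEquiv.subtypeEquiv he)]
  exact h
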